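/- arXiv:1006.1958 — 7 statements merged into one kernel-verified Lean document; each statement's English description precedes it below -/
import Mathlib

section
/- Let T be an effect-tribe on a nonempty set X satisfying (RDP), let m be a σ-algebra (measurable space structure) on X such that a set A ⊆ X is m-measurable if and only if the characteristic function χ_A belongs to T, and assume that every f ∈ T is m-measurable. Then for every σ-additive state s on T there is a unique probability measure μ on (X, m) such that s(f) = ∫_X f dμ for all f ∈ T; moreover this μ satisfies μ(A) = s(χ_A) for every m-measurable set A. -/
open MeasureTheory Topology Filter

/-- The characteristic function of a set `A`, valued in `ℝ`. -/
noncomputable def chi {X : Type*} (A : Set X) : X → ℝ := A.indicator 1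

/-- An effect-clan on `X`: a set of `[0,1]`-valued functions containing `1`, closed under
complement `f ↦ 1 - f`, and closed under sums `f + g` whenever `f + g ≤ 1` pointwise. -/
def IsEffectClan {X : Type*} (T : Set (X → ℝ)) : Prop :=
  (∀ f ∈ T, ∀ x, f x ∈ Set.Icc (0 : ℝ) 1) ∧
  (1 : X → ℝ) ∈ T ∧
  (∀ f ∈ T, (1 : X → ℝ) - f ∈ T) ∧
  (∀ f ∈ T, ∀ g ∈ T, (∀ x, f x + g x ≤ 1) → f + g ∈ T)

/-- An effect-tribe: an effect-clan closed under pointwise limits of pointwise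
nondecreasing sequences. -/
def IsEffectTribe {X : Type*} (T : Set (X → ℝ)) : Prop :=
  IsEffectClan T ∧
  ∀ (f : ℕ → X → ℝ) (g : X → ℝ), (∀ n, f n ∈ T) → (∀ n, f n ≤ f (n + 1)) →
    (∀ x, Filter.Tendsto (fun n => f n x) Filter.atTop (nhds (g x))) → g ∈ T

/-- The Riesz decomposition property for a set of functions. -/
def ClanRDP {X : Type*} (T : Set (X → ℝ)) : Prop :=
  ∀ f₁ ∈ T, ∀ f₂ ∈ T, ∀ g₁ ∈ T, ∀ g₂ ∈ T, f₁ + f₂ = g₁ + g₂ →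
    ∃ c₁₁ ∈ T, ∃ c₁₂ ∈ T, ∃ c₂₁ ∈ T, ∃ c₂₂ ∈ T,
      f₁ = c₁₁ + c₁₂ ∧ f₂ = c₂₁ + c₂₂ ∧ g₁ = c₁₁ + c₂₁ ∧ g₂ = c₁₂ + c₂₂

/-- A state on an effect-clan `T`. -/
def IsClanState {X : Type*} (T : Set (X → ℝ)) (s : (X → ℝ) → ℝ) : Prop :=
  (∀ f ∈ T, s f ∈ Set.Icc (0 : ℝ) 1) ∧
  s 1 = 1 ∧
  ∀ f ∈ T, ∀ g ∈ T, f + g ∈ T → s (f + g) = s f + s g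

/-- σ-additivity of a state: it is continuous along pointwise nondecreasing sequences
converging in `T`. -/
def IsSigmaAdditiveClanState {X : Type*} (T : Set (X → ℝ)) (s : (X → ℝ) → ℝ) : Prop :=
  IsClanState T s ∧
  ∀ (f : ℕ → X → ℝ) (g : X → ℝ), (∀ n, f n ∈ T) → (∀ n, f n ≤ f (n + 1)) →
    (∀ x, Filter.Tendsto (fun n => f n x) Filter.atTop (nhds (g x))) → g ∈ T →
      Filter.Tendsto (fun n => s (f n)) Filter.atTop (nhds (s g))

section EffectClan

variable {X : Type*} {T : Set (X → ℝ)} {s s' : (X → ℝ) → ℝ} {f : X → ℝ} {A : Set X}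

lemma chi_apply [DecidablePred (· ∈ A)] (x : X) : chi A x = if x ∈ A then 1 else 0 := by
  simp [chi, Set.indicator_apply]

lemma chi_union {A B : Set X} (h : Disjoint A B) : chi (A ∪ B) = chi A + chi B :=
  Set.indicator_union_of_disjoint h 1

lemma chi_compl (A : Set X) : chi Aᶜ = 1 - chi A :=
  Set.indicator_compl A 1

/-- By (RDP), restricting a member of the clan to a set in its Boolean part stays in the clan. -/
lemma IsEffectClan.indicator_mem (hT : IsEffectClan T) (hRDP : ClanRDP T) (hf : f ∈ T)
    (hA : chi A ∈ T) : A.indicator f ∈ T := by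
  classical
  obtain ⟨a, ha, b, hb, c, hc, d, hd, h₁, -, h₃, h₄⟩ :=
    hRDP f hf (1 - f) (hT.2.2.1 f hf) (chi A) hA (1 - chi A) (hT.2.2.1 _ hA) (by abel)
  convert ha using 1
  ext x
  have e₁ := congrFun h₁ x
  have e₃ := congrFun h₃ x
  have e₄ := congrFun h₄ x
  have ha0 := (hT.1 a ha x).1
  have hb0 := (hT.1 b hb x).1
  have hc0 := (hT.1 c hc x).1
  have hd0 := (hT.1 d hd x).1
  simp only [Pi.add_apply, Pi.sub_apply, Pi.one_apply, chi_apply] at e₁ e₃ e₄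
  by_cases hx : x ∈ A
  · simp only [hx, if_true, Set.indicator_of_mem] at e₃ e₄ ⊢
    linarith
  · simp only [hx, if_false, Set.indicator_of_notMem, not_false_eq_true] at e₃ e₄ ⊢
    linarith

/-- The binary shift `f ↦ 2 f - χ_{f > 1/2}` preserves the clan and every state commutes
with it. -/
lemma IsEffectClan.binaryShift (hT : IsEffectClan T) (hRDP : ClanRDP T) (hf : f ∈ T)
    (hA : chi {x | 1 / 2 < f x} ∈ T) :
    f + f - chi {x | 1 / 2 < f x} ∈ T ∧ ∀ s, IsClanState T s →
      s (f + f - chi {x | 1 / 2 < f x}) = 2 * s f - s (chi {x | 1 / 2 < f x}) := by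
  classical
  have hadd := hT.2.2.2
  set A := {x | 1 / 2 < f x} with hAdef
  have hAc : chi Aᶜ ∈ T := chi_compl A ▸ hT.2.2.1 _ hA
  set u := Aᶜ.indicator f with hu
  set v := A.indicator (1 - f) with hv
  set w := A.indicator f with hw
  have huT : u ∈ T := hT.indicator_mem hRDP hf hAc
  have hvT : v ∈ T := hT.indicator_mem hRDP (hT.2.2.1 _ hf) hA
  have hwT : w ∈ T := hT.indicator_mem hRDP hf hA
  have huu : u + u ∈ T := by
    refine hadd u huT u huT fun x => ?_
    by_cases hx : 1 / 2 < f x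
    · simp [hu, hAdef, -one_div, hx]
    · simp [hu, hAdef, -one_div, hx]
      linarith
  have hvv : v + v ∈ T := by
    refine hadd v hvT v hvT fun x => ?_
    by_cases hx : 1 / 2 < f x
    · simp [hv, hAdef, -one_div, hx]
      linarith
    · simp [hv, hAdef, -one_div, hx]
  set r := A.indicator (1 - (v + v)) with hr
  have hrT : r ∈ T := hT.indicator_mem hRDP (hT.2.2.1 _ hvv) hA
  have e₁ : f = u + w := (Set.indicator_compl_add_self A f).symm
  have e₂ : chi A = w + v := by
    ext x
    by_cases hx : x ∈ A <;> simp [hw, hv, chi, hx]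
  have e₃ : chi A = r + (v + v) := by
    ext x
    by_cases hx : x ∈ A <;> simp [hr, hv, chi, hx]
  have e₄ : f + f - chi A = (u + u) + r := by
    ext x
    by_cases hx : x ∈ A <;> simp [hr, hv, hu, chi, hx]
    ring
  have hmem : f + f - chi A ∈ T := by
    rw [e₄]
    refine hadd _ huu _ hrT fun x => ?_
    by_cases hx : x ∈ A
    · simpa [hu, hx] using (hT.1 _ hrT x).2
    · simpa [hr, hx] using (hT.1 _ huu x).2
  refine ⟨hmem, fun s hs => ?_⟩
  have s₁ := hs.2.2 u huT w hwT (e₁ ▸ hf)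
  have s₂ := hs.2.2 w hwT v hvT (e₂ ▸ hA)
  have s₃ := hs.2.2 r hrT _ hvv (e₃ ▸ hA)
  have s₄ := hs.2.2 _ huu r hrT (e₄ ▸ hmem)
  have s₅ := hs.2.2 u huT u huT huu
  have s₆ := hs.2.2 v hvT v hvT hvv
  rw [← e₁] at s₁
  rw [← e₂] at s₂
  rw [← e₃] at s₃
  rw [← e₄] at s₄
  linarith

/-- If the level sets `{f > 1/2}` belong to the Boolean part of the clan, a state is determined
by its values on characteristic functions: the binary shift doubles the difference of two states,
which is bounded. -/
lemma IsClanState.eq_of_eq_chi (hT : IsEffectClan T) (hRDP : ClanRDP T)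
    (hlev : ∀ f ∈ T, chi {x | 1 / 2 < f x} ∈ T) (hs : IsClanState T s) (hs' : IsClanState T s')
    (h : ∀ A, chi A ∈ T → s (chi A) = s' (chi A)) (hf : f ∈ T) : s f = s' f := by
  have key : ∀ n : ℕ, ∀ f ∈ T, 2 ^ n * |s f - s' f| ≤ 1 := by
    intro n
    induction n with
    | zero =>
      intro f hf
      have h₁ := hs.1 f hf
      have h₂ := hs'.1 f hf
      rw [pow_zero, one_mul, abs_le]
      constructor <;> linarith [h₁.1, h₁.2, h₂.1, h₂.2]
    | succ n ih =>
      intro f hf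
      obtain ⟨hmem, hshift⟩ := hT.binaryShift hRDP hf (hlev f hf)
      have := ih _ hmem
      rw [hshift s hs, hshift s' hs', h _ (hlev f hf), sub_sub_sub_cancel_right, ← mul_sub,
        abs_mul, abs_two] at this
      rwa [pow_succ, mul_assoc]
  by_contra hne
  have hpos : 0 < |s f - s' f| := abs_pos.2 (sub_ne_zero.2 hne)
  obtain ⟨n, hn⟩ := pow_unbounded_of_one_lt (1 / |s f - s' f|) one_lt_two
  exact absurd (key n f hf) (not_le.2 ((div_lt_iff₀ hpos).1 hn))

lemma IsClanState.map_chi_empty (hs : IsClanState T s) (h0 : chi ∅ ∈ T) :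
    s (chi (∅ : Set X)) = 0 := by
  have e : chi (∅ : Set X) + chi ∅ = chi ∅ := by ext x; simp [chi]
  have := hs.2.2 _ h0 _ h0 (e.symm ▸ h0)
  rw [e] at this
  linarith

end EffectClan

section Representation

variable {X : Type*} [MeasurableSpace X] {T : Set (X → ℝ)} {s : (X → ℝ) → ℝ}

lemma integral_chi (μ : Measure X) {A : Set X} (hA : MeasurableSet A) :
    ∫ x, chi A x ∂μ = μ.real A :=
  integral_indicator_one hA

lemma isClanState_integral (hT : IsEffectClan T) (hmeas : ∀ f ∈ T, Measurable f)
    (μ : Measure X) [IsProbabilityMeasure μ] : IsClanState T fun f => ∫ x, f x ∂μ := by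
  have hint : ∀ f ∈ T, Integrable f μ := fun f hf =>
    Integrable.of_mem_Icc 0 1 (hmeas f hf).aemeasurable (ae_of_all _ (hT.1 f hf))
  refine ⟨fun f hf => ⟨integral_nonneg fun x => (hT.1 f hf x).1, ?_⟩, by simp,
    fun f hf g hg _ => integral_add (hint f hf) (hint g hg)⟩
  simpa using integral_mono (hint f hf) (integrable_const 1) fun x => (hT.1 f hf x).2

lemma IsSigmaAdditiveClanState.hasSum_chi (hm : ∀ A : Set X, MeasurableSet A ↔ chi A ∈ T)
    (hs : IsSigmaAdditiveClanState T s) {A : ℕ → Set X} (hA : ∀ i, MeasurableSet (A i))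
    (hd : Pairwise (Function.onFun Disjoint A)) :
    HasSum (fun i => s (chi (A i))) (s (chi (⋃ i, A i))) := by
  rw [hasSum_iff_tendsto_nat_of_nonneg fun i => (hs.1.1 _ ((hm _).1 (hA i))).1]
  have hU : ∀ n, MeasurableSet (⋃ i < n, A i) := fun n =>
    .biUnion (Set.to_countable {i | i < n}) fun i _ => hA i
  have hsum : ∀ n, ∑ i ∈ Finset.range n, s (chi (A i)) = s (chi (⋃ i < n, A i)) := by
    intro n
    induction n with
    | zero => simpa using (hs.1.map_chi_empty ((hm _).1 .empty)).symm
    | succ n ih =>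
      have hdisj : Disjoint (⋃ i < n, A i) (A n) := by
        simp only [Set.disjoint_iUnion_left]
        exact fun i hi => hd hi.ne
      have e := chi_union hdisj
      rw [Finset.sum_range_succ, ih, Set.biUnion_lt_succ, e]
      exact (hs.1.2.2 _ ((hm _).1 (hU n)) _ ((hm _).1 (hA n))
        (e ▸ (hm _).1 ((hU n).union (hA n)))).symm
  simp only [hsum]
  have hmono : Monotone fun n => ⋃ i < n, A i := fun a b hab =>
    Set.biUnion_subset_biUnion_left fun i (hi : i < a) => hi.trans_le hab
  have hUnion : ⋃ n, ⋃ i < n, A i = ⋃ i, A i := by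
    ext x
    simp only [Set.mem_iUnion, exists_prop]
    exact ⟨fun ⟨_, i, _, h⟩ => ⟨i, h⟩, fun ⟨i, h⟩ => ⟨i + 1, i, i.lt_succ_self, h⟩⟩
  refine hs.2 _ _ (fun n => (hm _).1 (hU n)) (fun n => ?_) (fun x => ?_)
    ((hm _).1 (.iUnion hA))
  · exact Set.indicator_le_indicator_of_subset (hmono n.le_succ) fun _ => zero_le_one
  · rw [← hUnion]
    exact (hmono.tendsto_indicator _ 1 x).mono_right (pure_le_nhds _)

/-- The measure `A ↦ s (χ_A)` attached to a σ-additive state. -/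
noncomputable def IsSigmaAdditiveClanState.measure
    (hm : ∀ A : Set X, MeasurableSet A ↔ chi A ∈ T) (hs : IsSigmaAdditiveClanState T s) :
    Measure X :=
  Measure.ofMeasurable (fun A _ => ENNReal.ofReal (s (chi A)))
    (by simp [hs.1.map_chi_empty ((hm _).1 .empty)])
    fun A hA hd => by
      have h := hs.hasSum_chi hm hA hd
      rw [← h.tsum_eq]
      exact ENNReal.ofReal_tsum_of_nonneg (fun i => (hs.1.1 _ ((hm _).1 (hA i))).1) h.summable

lemma IsSigmaAdditiveClanState.measure_apply
    (hm : ∀ A : Set X, MeasurableSet A ↔ chi A ∈ T) (hs : IsSigmaAdditiveClanState T s)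
    {A : Set X} (hA : MeasurableSet A) : hs.measure hm A = ENNReal.ofReal (s (chi A)) :=
  Measure.ofMeasurable_apply A hA

end Representation

/-- Let `T` be an effect-tribe with (RDP) on `X ≠ ∅`, let `m` be a
σ-algebra on `X` whose measurable sets are exactly those with characteristic function
in `T`, and assume every `f ∈ T` is `m`-measurable.  Then every σ-additive state `s`
on `T` is represented by a unique probability measure `μ` on `(X, m)`, and this `μ`
satisfies `μ A = s (χ_A)` for all measurable `A`. -/
theorem stmt_2 {X : Type*} [Nonempty X] [m : MeasurableSpace X] (T : Set (X → ℝ))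
    (hT : IsEffectTribe T) (hRDP : ClanRDP T)
    (hm : ∀ A : Set X, MeasurableSet A ↔ chi A ∈ T)
    (hmeas : ∀ f ∈ T, Measurable f)
    (s : (X → ℝ) → ℝ) (hs : IsSigmaAdditiveClanState T s) :
    (∃! μ : Measure X, IsProbabilityMeasure μ ∧ ∀ f ∈ T, s f = ∫ x, f x ∂μ) ∧
    (∀ μ : Measure X, (IsProbabilityMeasure μ ∧ ∀ f ∈ T, s f = ∫ x, f x ∂μ) →
      ∀ A : Set X, MeasurableSet A → μ A = ENNReal.ofReal (s (chi A))) := by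
  have hval : ∀ μ : Measure X, (IsProbabilityMeasure μ ∧ ∀ f ∈ T, s f = ∫ x, f x ∂μ) →
      ∀ A : Set X, MeasurableSet A → μ A = ENNReal.ofReal (s (chi A)) := by
    rintro μ ⟨_, hμ⟩ A hA
    rw [hμ _ ((hm A).1 hA), integral_chi μ hA, ofReal_measureReal]
  refine ⟨⟨hs.measure hm, ?_, fun ν hν => ?_⟩, hval⟩
  · have hP : IsProbabilityMeasure (hs.measure hm) := ⟨by
      rw [hs.measure_apply hm .univ, chi, Set.indicator_univ, hs.1.2.1, ENNReal.ofReal_one]⟩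
    refine ⟨hP, fun f hf => ?_⟩
    refine hs.1.eq_of_eq_chi hT.1 hRDP
      (fun f hf => (hm _).1 (measurableSet_lt measurable_const (hmeas f hf)))
      (isClanState_integral hT.1 hmeas (hs.measure hm)) (fun A hA => ?_) hf
    rw [integral_chi _ ((hm A).2 hA), Measure.real, hs.measure_apply hm ((hm A).2 hA),
      ENNReal.toReal_ofReal (hs.1.1 _ hA).1]
  · exact Measure.ext fun A hA => by rw [hval ν hν A hA, hs.measure_apply hm hA]
end

section
/- Let G be an additive subgroup of the group of bounded real-valued functions on a nonempty set X, partially ordered pointwise, such that G has interpolation and the constant function 1 belongs to G and is a strong unit for G. Let T = {f ∈ G : 0 ≤ f ≤ 1 pointwise}, suppose T is closed under pointwise limits of nondecreasing sequences from T (so T is an effect-tribe), let m be a σ-algebra on X such that A is m-measurable iff χ_A ∈ T, and suppose every f ∈ T is m-measurable. Then every σ-additive state s on T extends to a unique state ŝ on (G, 1); this extension satisfies ŝ(f) = ∫_X f dμ_s for all f ∈ G, where μ_s is the probability measure on (X, m) determined by μ_s(A) = s(χ_A); and ŝ is σ-additive on G, i.e., if f_n ∈ G, f_n is nondecreasing and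 converges pointwise to f ∈ G, then ŝ(f_n) → ŝ(f). -/
open MeasureTheory Topology Filter

/-- A state on a unital po-group `(G, 1)` of real functions (ordered pointwise):
additive on `G`, nonnegative on nonnegative elements, and normalized at `1`. -/
def IsGroupState {X : Type*} (G : AddSubgroup (X → ℝ)) (t : (X → ℝ) → ℝ) : Prop :=
  (∀ f ∈ G, ∀ g ∈ G, t (f + g) = t f + t g) ∧
  (∀ f ∈ G, 0 ≤ f → 0 ≤ t f) ∧
  t 1 = 1

section EffectTribe

variable {X : Type*}

theorem natCast_comp_mem_of_chi_mem [MeasurableSpace X] {H : AddSubgroup (X → ℝ)}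
    (hH : ∀ A : Set X, MeasurableSet A → chi A ∈ H) (N : ℕ) (φ : X → ℕ) (hφ : Measurable φ)
    (hN : ∀ x, φ x ≤ N) : (fun x => (φ x : ℝ)) ∈ H := by
  induction N generalizing φ with
  | zero =>
    have : (fun x => (φ x : ℝ)) = 0 := by
      ext x
      simpa using hN x
    rw [this]
    exact H.zero_mem
  | succ N ih =>
    have hA : MeasurableSet {x | 1 ≤ φ x} := measurableSet_le measurable_const hφ
    have hpred : (fun x => ((φ x - 1 : ℕ) : ℝ)) ∈ H :=
      ih (fun x => φ x - 1) (hφ.sub_const 1) fun x => by have := hN x; omega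
    have : (fun x => (φ x : ℝ)) = chi {x | 1 ≤ φ x} + fun x => ((φ x - 1 : ℕ) : ℝ) := by
      ext x
      by_cases h : 1 ≤ φ x
      · simp [chi, Set.indicator, h]
      · have : φ x = 0 := by omega
        simp [chi, Set.indicator, this]
    rw [this]
    exact H.add_mem (hH _ hA) hpred

theorem intCast_comp_mem_of_chi_mem [MeasurableSpace X] {H : AddSubgroup (X → ℝ)}
    (hH : ∀ A : Set X, MeasurableSet A → chi A ∈ H) (N : ℕ) (φ : X → ℤ) (hφ : Measurable φ)
    (hlo : ∀ x, -(N : ℤ) ≤ φ x) (hhi : ∀ x, φ x ≤ N) : (fun x => (φ x : ℝ)) ∈ H := by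
  have hone : (1 : X → ℝ) ∈ H := by
    have := hH Set.univ MeasurableSet.univ
    rwa [chi, Set.indicator_univ] at this
  have hmeas : Measurable fun x => (φ x + N).toNat :=
    (measurable_of_countable Int.toNat).comp (hφ.add_const _)
  have hmem := natCast_comp_mem_of_chi_mem hH (2 * N) _ hmeas fun x => by
    have := hhi x; omega
  have : (fun x => (φ x : ℝ)) = (fun x => (((φ x + N).toNat : ℕ) : ℝ)) - N • (1 : X → ℝ) := by
    ext x
    have h : (((φ x + N).toNat : ℕ) : ℤ) = φ x + N :=
      Int.toNat_of_nonneg (by have := hlo x; omega)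
    have h' : (((φ x + N).toNat : ℕ) : ℝ) = (φ x : ℝ) + N := by exact_mod_cast h
    simp [h']
  rw [this]
  exact H.sub_mem hmem (H.nsmul_mem hone N)

theorem mem_closure_of_interpolation {G : AddSubgroup (X → ℝ)}
    (hbdd : ∀ f ∈ G, ∃ C : ℝ, ∀ x, |f x| ≤ C)
    (hinterp : ∀ f₁ ∈ G, ∀ f₂ ∈ G, ∀ g₁ ∈ G, ∀ g₂ ∈ G,
      f₁ ≤ g₁ → f₁ ≤ g₂ → f₂ ≤ g₁ → f₂ ≤ g₂ →
        ∃ h ∈ G, f₁ ≤ h ∧ f₂ ≤ h ∧ h ≤ g₁ ∧ h ≤ g₂)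
    (h1 : (1 : X → ℝ) ∈ G) {f : X → ℝ} (hf : f ∈ G) :
    f ∈ AddSubgroup.closure {f | f ∈ G ∧ ∀ x, f x ∈ Set.Icc (0 : ℝ) 1} := by
  set K := AddSubgroup.closure {f | f ∈ G ∧ ∀ x, f x ∈ Set.Icc (0 : ℝ) 1} with hK
  have hone : (1 : X → ℝ) ∈ K := AddSubgroup.subset_closure ⟨h1, fun x => by simp⟩
  have key : ∀ (N : ℕ) (g : X → ℝ), g ∈ G → (∀ x, 0 ≤ g x) → (∀ x, g x ≤ N) → g ∈ K := by
    intro N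
    induction N with
    | zero =>
      intro g _ h0 hN
      have : g = 0 := by
        ext x
        exact le_antisymm (by simpa using hN x) (h0 x)
      rw [this]
      exact K.zero_mem
    | succ N ih =>
      intro g hg h0 hN
      obtain ⟨h, hhG, hh0, hhlo, hhg, hh1⟩ := hinterp 0 G.zero_mem (g - N • (1 : X → ℝ))
        (G.sub_mem hg (G.nsmul_mem h1 N)) g hg 1 h1 h0 (fun x => by simp)
        (fun x => by simp) (fun x => by
          have := hN x
          push_cast at this
          simp
          linarith)
      have hrest : g - h ∈ K := by
        refine ih _ (G.sub_mem hg hhG) (fun x => ?_) (fun x => ?_)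
        · have := hhg x
          simpa using this
        · have := hhlo x
          simp at this ⊢
          linarith
      have hh : h ∈ K := AddSubgroup.subset_closure ⟨hhG, fun x => ⟨hh0 x, hh1 x⟩⟩
      simpa using K.add_mem hrest hh
  obtain ⟨C, hC⟩ := hbdd f hf
  obtain ⟨N, hN⟩ := exists_nat_ge C
  have hshift : f + N • (1 : X → ℝ) ∈ K := by
    refine key (2 * N) _ (G.add_mem hf (G.nsmul_mem h1 N)) (fun x => ?_) (fun x => ?_)
    · have := abs_le.1 (hC x)
      simp
      linarith
    · have := abs_le.1 (hC x)
      simp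
      linarith
  simpa using K.sub_mem hshift (K.nsmul_mem hone N)

theorem indicator_mem_of_interpolation {G : AddSubgroup (X → ℝ)}
    (hinterp : ∀ f₁ ∈ G, ∀ f₂ ∈ G, ∀ g₁ ∈ G, ∀ g₂ ∈ G,
      f₁ ≤ g₁ → f₁ ≤ g₂ → f₂ ≤ g₁ → f₂ ≤ g₂ →
        ∃ h ∈ G, f₁ ≤ h ∧ f₂ ≤ h ∧ h ≤ g₁ ∧ h ≤ g₂)
    (h1 : (1 : X → ℝ) ∈ G) {f : X → ℝ} (hf : f ∈ G) (hf01 : ∀ x, f x ∈ Set.Icc (0 : ℝ) 1)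
    {A : Set X} (hA : chi A ∈ G) : A.indicator f ∈ G := by
  have hA01 : ∀ x, chi A x ∈ Set.Icc (0 : ℝ) 1 := fun x => by
    by_cases h : x ∈ A <;> simp [chi, h]
  obtain ⟨h, hhG, hh0, hhlo, hhf, hhA⟩ := hinterp 0 G.zero_mem (f - (1 - chi A))
    (G.sub_mem hf (G.sub_mem h1 hA)) f hf (chi A) hA (fun x => (hf01 x).1)
    (fun x => (hA01 x).1) (fun x => by
      have := (hA01 x).2
      simp
      linarith) (fun x => by
      have := (hf01 x).2
      simp
      linarith)
  have : A.indicator f = h := by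
    ext x
    have e1 := hh0 x
    have e2 := hhlo x
    have e3 := hhf x
    have e4 := hhA x
    by_cases hx : x ∈ A
    · simp [chi, hx] at *
      linarith
    · simp [chi, hx] at *
      linarith
  rwa [this]

/-- The measure `A ↦ s (χ_A)` attached to a σ-additive state. -/
theorem exists_measure_of_sigmaAdditive [MeasurableSpace X] {T : Set (X → ℝ)}
    (hm : ∀ A : Set X, MeasurableSet A ↔ chi A ∈ T)
    {s : (X → ℝ) → ℝ} (hs : IsSigmaAdditiveClanState T s) :
    ∃ μ : Measure X, IsProbabilityMeasure μ ∧
      ∀ A : Set X, MeasurableSet A → μ A = ENNReal.ofReal (s (chi A)) := by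
  obtain ⟨⟨h01, hone, hadd⟩, hcont⟩ := hs
  have hunion : ∀ A B : Set X, MeasurableSet A → MeasurableSet B → Disjoint A B →
      s (chi (A ∪ B)) = s (chi A) + s (chi B) := by
    intro A B hA hB hAB
    have : chi (A ∪ B) = chi A + chi B := Set.indicator_union_of_disjoint hAB _
    rw [this]
    exact hadd _ ((hm A).1 hA) _ ((hm B).1 hB) (this ▸ (hm _).1 (hA.union hB))
  have hempty : s (chi (∅ : Set X)) = 0 := by
    have := hunion ∅ ∅ .empty .empty (by simp)
    simp at this
    exact this
  have hiUnion : ∀ A : ℕ → Set X, (∀ i, MeasurableSet (A i)) →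
      Pairwise (Function.onFun Disjoint A) →
      ENNReal.ofReal (s (chi (⋃ i, A i))) = ∑' i, ENNReal.ofReal (s (chi (A i))) := by
    intro A hA hd
    let B : ℕ → Set X := fun n => ⋃ i < n, A i
    have hB : ∀ n, MeasurableSet (B n) := fun n =>
      MeasurableSet.iUnion fun i => MeasurableSet.iUnion fun _ => hA i
    have hBsucc : ∀ n, B (n + 1) = B n ∪ A n := fun n => Set.biUnion_lt_succ A n
    have hsum : ∀ n, ENNReal.ofReal (s (chi (B n))) =
        ∑ i ∈ Finset.range n, ENNReal.ofReal (s (chi (A i))) := by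
      intro n
      induction n with
      | zero => simp [B, hempty]
      | succ n ih =>
        have hdisj : Disjoint (B n) (A n) := by
          simp only [B, Set.disjoint_iUnion_left]
          exact fun i hi => hd hi.ne
        rw [hBsucc, hunion _ _ (hB n) (hA n) hdisj, Finset.sum_range_succ, ← ih,
          ENNReal.ofReal_add (h01 _ ((hm _).1 (hB n))).1 (h01 _ ((hm _).1 (hA n))).1]
    have hmono : Monotone B := monotone_nat_of_le_succ fun n => by
      rw [hBsucc]; exact Set.subset_union_left
    have hU : ⋃ n, B n = ⋃ i, A i := by
      ext x
      simp only [B, Set.mem_iUnion]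
      exact ⟨fun ⟨_, i, _, h⟩ => ⟨i, h⟩, fun ⟨i, h⟩ => ⟨i + 1, i, i.lt_succ_self, h⟩⟩
    have hlim := hcont (fun n => chi (B n)) (chi (⋃ i, A i)) (fun n => (hm _).1 (hB n))
      (fun n => Set.indicator_le_indicator_of_subset (hmono n.le_succ) (fun _ => zero_le_one))
      (fun x => by
        rw [← hU]
        exact (hmono.tendsto_indicator B 1 x).mono_right (pure_le_nhds _))
      ((hm _).1 (MeasurableSet.iUnion hA))
    have hlim' := (ENNReal.continuous_ofReal.tendsto _).comp hlim
    refine tendsto_nhds_unique hlim' ?_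
    simp only [Function.comp_def, hsum]
    exact ENNReal.tendsto_nat_tsum _
  refine ⟨Measure.ofMeasurable (fun A _ => ENNReal.ofReal (s (chi A))) (by simp [hempty])
    (fun A hA hd => hiUnion A hA hd), ⟨?_⟩, fun A hA => Measure.ofMeasurable_apply A hA⟩
  rw [Measure.ofMeasurable_apply _ MeasurableSet.univ, chi, Set.indicator_univ, hone]
  simp

/-- A truncated form of additivity: carrying over the part of `u + v` exceeding `1`. -/
theorem state_add_eq_add_chi [MeasurableSpace X] {T : Set (X → ℝ)} {s : (X → ℝ) → ℝ}
    (hs : IsClanState T s)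
    (hcompl : ∀ f ∈ T, 1 - f ∈ T)
    (hind : ∀ f ∈ T, ∀ A : Set X, MeasurableSet A → A.indicator f ∈ T)
    {u v w : X → ℝ} (hu : u ∈ T) (hv : v ∈ T) (hw : w ∈ T) {A : Set X} (hA : MeasurableSet A)
    (hone : (1 : X → ℝ) ∈ T) (h : u + v = w + chi A) :
    s u + s v = s w + s (chi A) := by
  have hadd : ∀ f ∈ T, ∀ g ∈ T, ∀ k ∈ T, k = f + g → s k = s f + s g := by
    rintro f hf g hg _ hk rfl
    exact hs.2.2 f hf g hg hk
  have hsplit : ∀ f ∈ T, s f = s (A.indicator f) + s (Aᶜ.indicator f) := fun f hf =>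
    hadd _ (hind f hf A hA) _ (hind f hf _ hA.compl) f hf (A.indicator_self_add_compl f).symm
  have hx : ∀ x, u x + v x = w x + chi A x := fun x => congrFun h x
  have e1 : s (Aᶜ.indicator w) = s (Aᶜ.indicator u) + s (Aᶜ.indicator v) := by
    refine hadd _ (hind u hu _ hA.compl) _ (hind v hv _ hA.compl) _ (hind w hw _ hA.compl) ?_
    ext x
    have := hx x
    by_cases hxA : x ∈ A <;> simp [chi, hxA] at *
    linarith
  have e2 : s (A.indicator v) = s (A.indicator w) + s (A.indicator (1 - u)) := by
    refine hadd _ (hind w hw _ hA) _ (hind _ (hcompl u hu) _ hA) _ (hind v hv _ hA) ?_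
    ext x
    have := hx x
    by_cases hxA : x ∈ A <;> simp [chi, hxA] at *
    linarith
  have e3 : s (chi A) = s (A.indicator u) + s (A.indicator (1 - u)) := by
    refine hadd _ (hind u hu _ hA) _ (hind _ (hcompl u hu) _ hA) _ (hind 1 hone _ hA) ?_
    ext x
    by_cases hxA : x ∈ A <;> simp [chi, hxA]
  rw [hsplit u hu, hsplit v hv, hsplit w hw]
  linarith

theorem fract_add_fract_eq_add_chi (f g : X → ℝ) :
    (fun x => Int.fract (f x)) + (fun x => Int.fract (g x)) =
      (fun x => Int.fract ((f + g) x)) + chi {x | 1 ≤ Int.fract (f x) + Int.fract (g x)} := by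
  ext x
  have hf := Int.fract_nonneg (f x)
  have hg := Int.fract_nonneg (g x)
  have hf' := Int.fract_lt_one (f x)
  have hg' := Int.fract_lt_one (g x)
  have ef := Int.floor_add_fract (f x)
  have eg := Int.floor_add_fract (g x)
  by_cases h : 1 ≤ Int.fract (f x) + Int.fract (g x)
  · have : Int.fract (f x + g x) = Int.fract (f x) + Int.fract (g x) - 1 :=
      Int.fract_eq_iff.2 ⟨by linarith, by linarith, ⌊f x⌋ + ⌊g x⌋ + 1, by push_cast; linarith⟩
    simp [chi, h, this]
  · have : Int.fract (f x + g x) = Int.fract (f x) + Int.fract (g x) :=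
      Int.fract_eq_iff.2 ⟨by linarith, by linarith, ⌊f x⌋ + ⌊g x⌋, by push_cast; linarith⟩
    simp [chi, h, this]

/-- A bounded additive map on a subgroup vanishes. -/
theorem eq_zero_of_additive_of_bounded {G : AddSubgroup (X → ℝ)} {D : (X → ℝ) → ℝ}
    (hadd : ∀ f ∈ G, ∀ g ∈ G, D (f + g) = D f + D g) {C : ℝ} (hC : ∀ f ∈ G, |D f| ≤ C)
    {f : X → ℝ} (hf : f ∈ G) : D f = 0 := by
  have h0 : D 0 = 0 := by
    have := hadd 0 G.zero_mem 0 G.zero_mem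
    simpa using this
  have hn : ∀ n : ℕ, D (n • f) = n * D f := by
    intro n
    induction n with
    | zero => simpa using h0
    | succ n ih =>
      rw [succ_nsmul, hadd _ (G.nsmul_mem hf n) _ hf, ih]
      push_cast
      ring
  by_contra hne
  obtain ⟨n, hnC⟩ := exists_nat_gt (C / |D f|)
  have hb := hC _ (G.nsmul_mem hf n)
  rw [hn, abs_mul, Nat.abs_cast] at hb
  rw [div_lt_iff₀ (abs_pos.2 hne)] at hnC
  linarith

end EffectTribe

/-- Let `(G, 1)` be an interpolation unital po-group of bounded functions
on `X ≠ ∅`, let `T = Γ(G,1)` be an effect-tribe, let `m` be a σ-algebra on `X` whose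
measurable sets are exactly those with characteristic function in `T`, and suppose every
`f ∈ T` is measurable.  Then every σ-additive state `s` on `T` extends to a unique state
`ŝ` on `(G, 1)`; the extension is given by integration against the probability measure
`μ_s` determined by `μ_s A = s (χ_A)`, and `ŝ` is σ-additive on `G`. -/
theorem stmt_3 {X : Type*} [Nonempty X] [m : MeasurableSpace X]
    (G : AddSubgroup (X → ℝ))
    (hbdd : ∀ f ∈ G, ∃ C : ℝ, ∀ x, |f x| ≤ C)
    (hinterp : ∀ f₁ ∈ G, ∀ f₂ ∈ G, ∀ g₁ ∈ G, ∀ g₂ ∈ G,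
      f₁ ≤ g₁ → f₁ ≤ g₂ → f₂ ≤ g₁ → f₂ ≤ g₂ →
        ∃ h ∈ G, f₁ ≤ h ∧ f₂ ≤ h ∧ h ≤ g₁ ∧ h ≤ g₂)
    (h1 : (1 : X → ℝ) ∈ G)
    (hsu : ∀ f ∈ G, ∃ n : ℕ, 0 < n ∧ f ≤ n • (1 : X → ℝ))
    (T : Set (X → ℝ)) (hTdef : T = {f | f ∈ G ∧ ∀ x, f x ∈ Set.Icc (0 : ℝ) 1})
    (hTtribe : IsEffectTribe T)
    (hm : ∀ A : Set X, MeasurableSet A ↔ chi A ∈ T)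
    (hmeas : ∀ f ∈ T, Measurable f)
    (s : (X → ℝ) → ℝ) (hs : IsSigmaAdditiveClanState T s) :
    ∃ shat : (X → ℝ) → ℝ,
      (IsGroupState G shat ∧ ∀ f ∈ T, shat f = s f) ∧
      (∀ t : (X → ℝ) → ℝ, IsGroupState G t → (∀ f ∈ T, t f = s f) →
        ∀ f ∈ G, t f = shat f) ∧
      (∀ μ : Measure X, IsProbabilityMeasure μ →
        (∀ A : Set X, MeasurableSet A → μ A = ENNReal.ofReal (s (chi A))) →
          ∀ f ∈ G, shat f = ∫ x, f x ∂μ) ∧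
      (∀ (fn : ℕ → X → ℝ) (f : X → ℝ), (∀ n, fn n ∈ G) → (∀ n, fn n ≤ fn (n + 1)) →
        (∀ x, Filter.Tendsto (fun n => fn n x) Filter.atTop (nhds (f x))) → f ∈ G →
          Filter.Tendsto (fun n => shat (fn n)) Filter.atTop (nhds (shat f))) := by
  have hT : ∀ f, f ∈ T ↔ f ∈ G ∧ ∀ x, f x ∈ Set.Icc (0 : ℝ) 1 := fun f => by rw [hTdef]; rfl
  have hchi : ∀ A : Set X, MeasurableSet A → chi A ∈ G := fun A hA => ((hT _).1 ((hm A).1 hA)).1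
  have hgen : ∀ f ∈ G, f ∈ AddSubgroup.closure T := fun f hf => by
    rw [hTdef]
    exact mem_closure_of_interpolation hbdd hinterp h1 hf
  have hmeasG : ∀ f ∈ G, Measurable f := fun f hf =>
    AddSubgroup.closure_induction (p := fun f _ => Measurable f) hmeas measurable_const
      (fun _ _ _ _ hf hg => hf.add hg) (fun _ _ hf => hf.neg) (hgen f hf)
  obtain ⟨μ, hμ, hμs⟩ := exists_measure_of_sigmaAdditive hm hs
  have hint : ∀ f ∈ G, Integrable f μ := fun f hf => by
    obtain ⟨C, hC⟩ := hbdd f hf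
    exact Integrable.of_bound (hmeasG f hf).aestronglyMeasurable C (ae_of_all _ hC)
  have hone : (1 : X → ℝ) ∈ T := hTtribe.1.2.1
  have hcompl : ∀ f ∈ T, 1 - f ∈ T := hTtribe.1.2.2.1
  have hT01 := hTtribe.1.1
  have hind : ∀ f ∈ T, ∀ A : Set X, MeasurableSet A → A.indicator f ∈ T := by
    intro f hf A hA
    refine (hT _).2 ⟨indicator_mem_of_interpolation hinterp h1 ((hT f).1 hf).1 (hT01 f hf)
      (hchi A hA), fun x => ?_⟩
    by_cases hx : x ∈ A
    · simpa [hx] using hT01 f hf x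
    · simp [hx]
  have hfract : ∀ f ∈ G, (fun x => Int.fract (f x)) ∈ T := by
    intro f hf
    refine (hT _).2 ⟨?_, fun x => ⟨Int.fract_nonneg _, (Int.fract_lt_one _).le⟩⟩
    obtain ⟨C, hC⟩ := hbdd f hf
    obtain ⟨N, hN⟩ := exists_nat_ge C
    refine G.sub_mem hf (intCast_comp_mem_of_chi_mem hchi N (fun x => ⌊f x⌋)
      (Int.measurable_floor.comp (hmeasG f hf)) (fun x => ?_) (fun x => ?_))
    · have := abs_le.1 (hC x)
      exact Int.le_floor.2 (by push_cast; linarith)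
    · have := abs_le.1 (hC x)
      have hfl := Int.floor_le (f x)
      exact_mod_cast hfl.trans (this.2.trans hN)
  have hchi_int : ∀ A : Set X, MeasurableSet A → s (chi A) = ∫ x, chi A x ∂μ := by
    intro A hA
    rw [chi, integral_indicator_one hA, Measure.real, hμs A hA,
      ENNReal.toReal_ofReal (hs.1.1 _ ((hm A).1 hA)).1]
    rfl
  have hdefect : ∀ u ∈ T, ∀ v ∈ T, ∀ w ∈ T, ∀ A : Set X, MeasurableSet A → u + v = w + chi A →
      (s u - ∫ x, u x ∂μ) + (s v - ∫ x, v x ∂μ) = s w - ∫ x, w x ∂μ := by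
    intro u hu v hv w hw A hA h
    have e1 := state_add_eq_add_chi hs.1 hcompl hind hu hv hw hA hone h
    have e2 : ∫ x, (u + v) x ∂μ = ∫ x, (w + chi A) x ∂μ := by rw [h]
    rw [integral_add' (hint u ((hT u).1 hu).1) (hint v ((hT v).1 hv).1),
      integral_add' (hint w ((hT w).1 hw).1) (hint _ (hchi A hA)), ← hchi_int A hA] at e2
    linarith
  have hzero : ∀ f ∈ G, s (fun x => Int.fract (f x)) - ∫ x, Int.fract (f x) ∂μ = 0 := by
    intro f hf
    refine eq_zero_of_additive_of_bounded (G := G)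
      (D := fun f => s (fun x => Int.fract (f x)) - ∫ x, Int.fract (f x) ∂μ)
      (fun f hf g hg => ?_) (C := 1) (fun f hf => ?_) hf
    · exact (hdefect _ (hfract f hf) _ (hfract g hg) _ (hfract _ (G.add_mem hf hg)) _
        (measurableSet_le measurable_const
          ((hmeas _ (hfract f hf)).add (hmeas _ (hfract g hg))))
        (fract_add_fract_eq_add_chi f g)).symm
    · have hs01 := hs.1.1 _ (hfract f hf)
      have hi0 : 0 ≤ ∫ x, Int.fract (f x) ∂μ := integral_nonneg fun x => Int.fract_nonneg _
      have hi1 : ∫ x, Int.fract (f x) ∂μ ≤ ∫ _, (1 : ℝ) ∂μ :=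
        integral_mono (hint _ ((hT _).1 (hfract f hf)).1) (integrable_const _)
          fun x => (Int.fract_lt_one _).le
      simp at hi1
      exact abs_le.2 ⟨by linarith [hs01.1], by linarith [hs01.2]⟩
  have hsT : ∀ f ∈ T, ∫ x, f x ∂μ = s f := by
    intro f hf
    have hfG := ((hT f).1 hf).1
    have hz : (0 : X → ℝ) ∈ T := (hT 0).2 ⟨G.zero_mem, fun x => by simp⟩
    have hs0 : s 0 = 0 := by
      have := hs.1.2.2 0 hz 0 hz (by simpa using hz)
      simpa using this
    have hsum : f + 0 = (fun x => Int.fract (f x)) + chi {x | 1 ≤ f x} := by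
      ext x
      have h01 := hT01 f hf x
      by_cases h : 1 ≤ f x
      · have : f x = 1 := le_antisymm h01.2 h
        simp [chi, this]
      · simp [chi, h, Int.fract_eq_self.2 ⟨h01.1, not_le.1 h⟩]
    have e := hdefect f hf 0 hz _ (hfract f hfG) _
      (measurableSet_le measurable_const (hmeas f hf)) hsum
    rw [hzero f hfG] at e
    simp [hs0] at e
    linarith
  refine ⟨fun f => ∫ x, f x ∂μ, ⟨⟨fun f hf g hg => integral_add' (hint f hf) (hint g hg),
    fun f _ h => integral_nonneg h, by simp⟩, hsT⟩, ?_, ?_, ?_⟩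
  · intro t ht hts f hf
    have hTG : AddSubgroup.closure T ≤ G :=
      (AddSubgroup.closure_le G).2 fun f hf => ((hT f).1 hf).1
    have ht0 : t 0 = 0 := by
      have := ht.1 0 G.zero_mem 0 G.zero_mem
      simpa using this
    refine AddSubgroup.closure_induction (p := fun f _ => t f = ∫ x, f x ∂μ)
      (fun f hf => by rw [hts f hf, hsT f hf]) (by simp [ht0]) (fun f g hf hg ihf ihg => ?_)
      (fun f hf ih => ?_) (hgen f hf)
    · rw [ht.1 f (hTG hf) g (hTG hg), integral_add' (hint f (hTG hf)) (hint g (hTG hg)), ihf, ihg]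
    · have h := ht.1 f (hTG hf) (-f) (G.neg_mem (hTG hf))
      rw [add_neg_cancel, ht0] at h
      rw [integral_neg', ← ih]
      linarith
  · intro ν _ hν f _
    have : ν = μ := Measure.ext fun A hA => by rw [hν A hA, hμs A hA]
    rw [this]
  · intro fn f hfn hmono hlim hf
    exact integral_tendsto_of_tendsto_of_monotone (fun n => hint _ (hfn n)) (hint f hf)
      (ae_of_all _ fun x => monotone_nat_of_le_succ fun n => hmono n x) (ae_of_all _ hlim)
end

section
/- Let T be an effect-tribe on a nonempty set X satisfying (RDP), and let m be a σ-algebra on X such that A ⊆ X is m-measurable if and only if χ_A ∈ T. Let T' = {f ∈ T : f is m-measurable}. Then T' is itself an effect-tribe on X, the sets A with χ_A ∈ T' are exactly those with χ_A ∈ T, and for every σ-additive state s on T there is a probability measure μ_s on (X, m) with μ_s(A) = s(χ_A) for every m-measurable A such that s(f) = ∫_X f dμ_s for every f ∈ T'. -/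
open MeasureTheory Topology Filter

section EffectTribe

variable {X : Type*} {T : Set (X → ℝ)}

lemma chi_empty : chi (∅ : Set X) = 0 := Set.indicator_empty 1

lemma chi_univ : chi (Set.univ : Set X) = 1 := by simp [chi]

lemma chi_add_chi_compl (A : Set X) : chi A + chi Aᶜ = 1 :=
  Set.indicator_self_add_compl A 1

lemma measurable_chi [MeasurableSpace X] {A : Set X} (hA : MeasurableSet A) :
    Measurable (chi A) :=
  measurable_one.indicator hA

lemma IsEffectClan.sub_mem (hT : IsEffectClan T) {f g : X → ℝ} (hf : f ∈ T) (hg : g ∈ T)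
    (h : ∀ x, f x ≤ g x) : g - f ∈ T := by
  obtain ⟨-, -, hcompl, hadd⟩ := hT
  have hmem := hcompl _ (hadd _ (hcompl g hg) f hf fun x => by
    simp only [Pi.sub_apply, Pi.one_apply]; linarith [h x])
  convert hmem using 1
  ext x
  simp only [Pi.sub_apply, Pi.add_apply, Pi.one_apply]
  ring

lemma IsEffectClan.zero_mem (hT : IsEffectClan T) : (0 : X → ℝ) ∈ T := by
  simpa using hT.2.2.1 1 hT.2.1

/-- By Riesz decomposition, a member of an effect-clan can be cut off to a set whose
characteristic function and that of its complement are in the clan. -/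
lemma IsEffectClan.mul_chi_mem (hT : IsEffectClan T) (hRDP : ClanRDP T) {f : X → ℝ} {A : Set X}
    (hf : f ∈ T) (hA : chi A ∈ T) (hA' : chi Aᶜ ∈ T) : f * chi A ∈ T := by
  obtain ⟨c, hc, d, hd, c', hc', d', hd', h₁, -, h₃, h₄⟩ :=
    hRDP f hf (1 - f) (hT.2.2.1 f hf) (chi A) hA (chi Aᶜ) hA' (by
      rw [chi_add_chi_compl, add_sub_cancel])
  convert hc using 1
  ext x
  have h₁ := congrFun h₁ x
  have h₃ := congrFun h₃ x
  have h₄ := congrFun h₄ x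
  have hcx := (hT.1 c hc x).1
  have hdx := (hT.1 d hd x).1
  have hcx' := (hT.1 c' hc' x).1
  have hdx' := (hT.1 d' hd' x).1
  by_cases hx : x ∈ A
  · simp [chi, hx] at h₁ h₃ h₄ ⊢
    linarith
  · simp [chi, hx] at h₁ h₃ h₄ ⊢
    linarith

lemma IsClanState.map_zero {s : (X → ℝ) → ℝ} (hs : IsClanState T s) (hT : IsEffectClan T) :
    s 0 = 0 := by
  have h := hs.2.2 0 hT.zero_mem 0 hT.zero_mem (by simpa using hT.zero_mem)
  rw [add_zero] at h
  linarith

/-- The doubling map `f ↦ 2 f mod 1` on the measurable members of an effect-clan. -/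
lemma IsEffectClan.doubling [MeasurableSpace X] (hT : IsEffectClan T) (hRDP : ClanRDP T)
    (hm : ∀ A : Set X, MeasurableSet A ↔ chi A ∈ T) {s : (X → ℝ) → ℝ} (hs : IsClanState T s)
    {f : X → ℝ} (hf : f ∈ T) (hfm : Measurable f) :
    ∃ A : Set X, MeasurableSet A ∧ (2 : ℝ) • f - chi A ∈ T ∧
      s ((2 : ℝ) • f - chi A) = 2 * s f - s (chi A) := by
  obtain ⟨hT01, -, -, hadd⟩ := id hT
  have hsadd := hs.2.2
  set A : Set X := {x | 1 / 2 ≤ f x} with hAdef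
  have hA : MeasurableSet A := measurableSet_le measurable_const hfm
  have hχ := (hm A).1 hA
  have hχ' := (hm Aᶜ).1 hA.compl
  have ha : f * chi A ∈ T := hT.mul_chi_mem hRDP hf hχ hχ'
  have hb : f * chi Aᶜ ∈ T := hT.mul_chi_mem hRDP hf hχ' (by rwa [compl_compl])
  have hcases : ∀ x, (chi A x = 1 ∧ chi Aᶜ x = 0 ∧ 1 / 2 ≤ f x) ∨
      (chi A x = 0 ∧ chi Aᶜ x = 1 ∧ f x < 1 / 2) := fun x => by
    by_cases hx : x ∈ A
    · exact .inl ⟨by simp [chi, hx], by simp [chi, hx], hx⟩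
    · exact .inr ⟨by simp [chi, hx], by simp [chi, hx], not_le.1 hx⟩
  have hfab : f * chi A + f * chi Aᶜ = f := by rw [← mul_add, chi_add_chi_compl, mul_one]
  generalize haeq : f * chi A = a at *
  generalize hbeq : f * chi Aᶜ = b at *
  have hax : ∀ x, f x * chi A x = a x := fun x => congrFun haeq x
  have hbx : ∀ x, f x * chi Aᶜ x = b x := fun x => congrFun hbeq x
  have hval : ∀ x, (chi A x = 1 ∧ a x = f x ∧ b x = 0 ∧ 1 / 2 ≤ f x ∧ f x ≤ 1) ∨
      (chi A x = 0 ∧ a x = 0 ∧ b x = f x ∧ f x < 1 / 2 ∧ 0 ≤ f x) := fun x => by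
    rw [← hax, ← hbx]
    rcases hcases x with ⟨h₁, h₂, h₃⟩ | ⟨h₁, h₂, h₃⟩
    · exact .inl ⟨h₁, by simp [h₁], by simp [h₂], h₃, (hT01 f hf x).2⟩
    · exact .inr ⟨h₁, by simp [h₁], by simp [h₂], h₃, (hT01 f hf x).1⟩
  have hc : chi A - a ∈ T := hT.sub_mem ha hχ fun x => by rcases hval x with h | h <;> linarith
  have hcc : (chi A - a) + (chi A - a) ∈ T := hadd _ hc _ hc fun x => by
    simp only [Pi.sub_apply]; rcases hval x with h | h <;> linarith
  have hd : chi A - ((chi A - a) + (chi A - a)) ∈ T := hT.sub_mem hcc hχ fun x => by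
    simp only [Pi.sub_apply, Pi.add_apply]; rcases hval x with h | h <;> linarith
  have hbb : b + b ∈ T := hadd _ hb _ hb fun x => by rcases hval x with h | h <;> linarith
  have hh : (b + b) + (chi A - ((chi A - a) + (chi A - a))) ∈ T := hadd _ hbb _ hd fun x => by
    simp only [Pi.sub_apply, Pi.add_apply]; rcases hval x with h | h <;> linarith
  have heq : (b + b) + (chi A - ((chi A - a) + (chi A - a))) = (2 : ℝ) • f - chi A := by
    rw [← hfab, two_smul]; abel
  refine ⟨A, hA, heq ▸ hh, ?_⟩
  have e₁ := hsadd _ ha _ hb (by rwa [hfab])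
  have e₂ := hsadd _ ha _ hc (by rwa [add_sub_cancel])
  have e₃ := hsadd _ hc _ hc hcc
  have e₄ := hsadd _ hcc _ hd (by rwa [add_sub_cancel])
  have e₅ := hsadd _ hb _ hb hbb
  have e₆ := hsadd _ hbb _ hd hh
  rw [hfab] at e₁
  rw [add_sub_cancel] at e₂ e₄
  rw [heq] at e₆
  linarith

lemma IsClanState.map_chi_biUnion [MeasurableSpace X] {s : (X → ℝ) → ℝ} (hs : IsClanState T s)
    (hT : IsEffectClan T) (hm : ∀ A : Set X, MeasurableSet A ↔ chi A ∈ T) {A : ℕ → Set X}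
    (hA : ∀ i, MeasurableSet (A i)) (hdisj : Pairwise (Function.onFun Disjoint A)) (n : ℕ) :
    s (chi (⋃ i ∈ Finset.range n, A i)) = ∑ i ∈ Finset.range n, s (chi (A i)) := by
  induction n with
  | zero => simp [chi_empty, hs.map_zero hT]
  | succ n ih =>
    have hU : MeasurableSet (⋃ i ∈ Finset.range n, A i) :=
      Finset.measurableSet_biUnion _ fun i _ => hA i
    have hd : Disjoint (⋃ i ∈ Finset.range n, A i) (A n) := by
      simp only [Set.disjoint_iUnion_left, Finset.mem_range]
      exact fun i hi => hdisj hi.ne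
    have heq : ⋃ i ∈ Finset.range (n + 1), A i = (⋃ i ∈ Finset.range n, A i) ∪ A n := by
      rw [Finset.range_add_one, Finset.set_biUnion_insert, Set.union_comm]
    have hχ : chi ((⋃ i ∈ Finset.range n, A i) ∪ A n) =
        chi (⋃ i ∈ Finset.range n, A i) + chi (A n) :=
      Set.indicator_union_of_disjoint hd 1
    rw [Finset.sum_range_succ, ← ih, heq, hχ]
    exact hs.2.2 _ ((hm _).1 hU) _ ((hm _).1 (hA n)) (hχ ▸ (hm _).1 (hU.union (hA n)))

/-- A σ-additive state restricts to a probability measure on the sets whose characteristic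
function is in the clan. -/
lemma IsSigmaAdditiveClanState.exists_measure [MeasurableSpace X] {s : (X → ℝ) → ℝ}
    (hs : IsSigmaAdditiveClanState T s) (hT : IsEffectClan T)
    (hm : ∀ A : Set X, MeasurableSet A ↔ chi A ∈ T) :
    ∃ μ : Measure X, IsProbabilityMeasure μ ∧
      ∀ A : Set X, MeasurableSet A → μ A = ENNReal.ofReal (s (chi A)) := by
  have hμ := Measure.ofMeasurable_apply (m := fun A _ => ENNReal.ofReal (s (chi A)))
    (m0 := by simp [chi_empty, hs.1.map_zero hT])
    (mU := fun A hA hdisj => by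
      refine tendsto_nhds_unique ?_ ENNReal.summable.hasSum.tendsto_sum_nat
      have hmono : Monotone fun n => ⋃ i ∈ Finset.range n, A i := fun n k hnk =>
        Set.biUnion_subset_biUnion_left (Finset.range_mono hnk)
      have hU : ⋃ n, ⋃ i ∈ Finset.range n, A i = ⋃ i, A i := by
        ext x
        simp only [Set.mem_iUnion, Finset.mem_range]
        exact ⟨fun ⟨_, i, _, hi⟩ => ⟨i, hi⟩, fun ⟨i, hi⟩ => ⟨i + 1, i, i.lt_succ_self, hi⟩⟩
      have hlim := hs.2 (fun n => chi (⋃ i ∈ Finset.range n, A i)) (chi (⋃ i, A i))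
        (fun n => (hm _).1 (Finset.measurableSet_biUnion _ fun i _ => hA i))
        (fun n => Set.indicator_le_indicator_of_subset (hmono n.le_succ) fun _ => zero_le_one)
        (fun x => by
          have h := hmono.tendsto_indicator _ (1 : X → ℝ) x
          rw [hU] at h
          exact h.mono_right (pure_le_nhds _))
        ((hm _).1 (.iUnion hA))
      refine (ENNReal.tendsto_ofReal hlim).congr fun n => ?_
      rw [hs.1.map_chi_biUnion hT hm hA hdisj, ENNReal.ofReal_sum_of_nonneg]
      exact fun i _ => (hs.1.1 _ ((hm _).1 (hA i))).1)
  refine ⟨_, ⟨?_⟩, hμ⟩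
  rw [hμ _ .univ, chi_univ, hs.1.2.1, ENNReal.ofReal_one]

/-- A state on an effect-clan with Riesz decomposition is, on measurable members, the integral
against any probability measure that agrees with it on characteristic functions. -/
lemma IsClanState.eq_integral [MeasurableSpace X] {s : (X → ℝ) → ℝ} (hs : IsClanState T s)
    (hT : IsEffectClan T) (hRDP : ClanRDP T) (hm : ∀ A : Set X, MeasurableSet A ↔ chi A ∈ T)
    (μ : Measure X) [IsProbabilityMeasure μ]
    (hμ : ∀ A : Set X, MeasurableSet A → μ A = ENNReal.ofReal (s (chi A)))
    {f : X → ℝ} (hf : f ∈ T) (hfm : Measurable f) : s f = ∫ x, f x ∂μ := by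
  have hint : ∀ f ∈ T, Measurable f → Integrable f μ := fun f hf hfm =>
    .of_mem_Icc 0 1 hfm.aemeasurable (.of_forall (hT.1 f hf))
  have key : ∀ n : ℕ, ∀ f ∈ T, Measurable f → |s f - ∫ x, f x ∂μ| ≤ (1 / 2) ^ n := by
    intro n
    induction n with
    | zero =>
      intro f hf hfm
      have h₀ : 0 ≤ ∫ x, f x ∂μ := integral_nonneg fun x => (hT.1 f hf x).1
      have h₁ : ∫ x, f x ∂μ ≤ ∫ _, (1 : ℝ) ∂μ :=
        integral_mono (hint f hf hfm) (integrable_const 1) fun x => (hT.1 f hf x).2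
      rw [integral_const, probReal_univ, one_smul] at h₁
      have h₂ := hs.1 f hf
      rw [pow_zero, abs_le]
      constructor <;> linarith [h₂.1, h₂.2]
    | succ n ih =>
      intro f hf hfm
      obtain ⟨A, hA, hmem, hsA⟩ := hT.doubling hRDP hm hs hf hfm
      have hχ := (hm A).1 hA
      have h := ih _ hmem ((hfm.const_smul (2 : ℝ)).sub (measurable_chi hA))
      have hAint : ∫ x, chi A x ∂μ = s (chi A) := by
        rw [chi, integral_indicator_one hA, measureReal_def, hμ A hA,
          ENNReal.toReal_ofReal (hs.1 _ hχ).1, chi]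
      have hdbl : ∫ x, ((2 : ℝ) • f - chi A) x ∂μ = 2 * ∫ x, f x ∂μ - s (chi A) := by
        rw [integral_sub' ((hint f hf hfm).smul (2 : ℝ)) (hint _ hχ (measurable_chi hA)), hAint]
        simp [integral_const_mul]
      rw [hsA, hdbl, abs_le] at h
      rw [pow_succ, abs_le]
      constructor <;> linarith [h.1, h.2]
  have hlim := tendsto_pow_atTop_nhds_zero_of_lt_one (r := (1 / 2 : ℝ)) (by norm_num) (by norm_num)
  exact sub_eq_zero.1 (abs_nonpos_iff.1 (ge_of_tendsto' hlim fun n => key n f hf hfm))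

lemma IsEffectTribe.inter_measurable [MeasurableSpace X] (hT : IsEffectTribe T) :
    IsEffectTribe {f ∈ T | Measurable f} := by
  obtain ⟨⟨h01, hone, hcompl, hadd⟩, hlim⟩ := hT
  refine ⟨⟨fun f hf => h01 f hf.1, ⟨hone, measurable_one⟩,
    fun f hf => ⟨hcompl f hf.1, measurable_one.sub hf.2⟩,
    fun f hf g hg h => ⟨hadd f hf.1 g hg.1 h, hf.2.add hg.2⟩⟩, fun f g hf hmono hfg => ?_⟩
  exact ⟨hlim f g (fun n => (hf n).1) hmono hfg,
    measurable_of_tendsto_metrizable (fun n => (hf n).2) (tendsto_pi_nhds.2 hfg)⟩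

end EffectTribe

/-- Let `T` be an effect-tribe with (RDP) on `X ≠ ∅` and `m` a σ-algebra
on `X` whose measurable sets are exactly those with characteristic function in `T`.
Let `T'` be the set of `m`-measurable members of `T`.  Then `T'` is an effect-tribe,
`χ_A ∈ T' ↔ χ_A ∈ T`, and every σ-additive state `s` on `T` is represented on `T'` by
the probability measure determined by `μ_s A = s (χ_A)`. -/
theorem stmt_4 {X : Type*} [Nonempty X] [m : MeasurableSpace X] (T : Set (X → ℝ))
    (hT : IsEffectTribe T) (hRDP : ClanRDP T)
    (hm : ∀ A : Set X, MeasurableSet A ↔ chi A ∈ T)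
    (T' : Set (X → ℝ)) (hT' : T' = {f ∈ T | Measurable f}) :
    IsEffectTribe T' ∧
    (∀ A : Set X, chi A ∈ T' ↔ chi A ∈ T) ∧
    ∀ s : (X → ℝ) → ℝ, IsSigmaAdditiveClanState T s →
      ∃ μ : Measure X, IsProbabilityMeasure μ ∧
        (∀ A : Set X, MeasurableSet A → μ A = ENNReal.ofReal (s (chi A))) ∧
        ∀ f ∈ T', s f = ∫ x, f x ∂μ := by
  subst hT'
  refine ⟨hT.inter_measurable, fun A => ⟨fun h => h.1, fun h => ⟨h, measurable_chi ((hm A).2 h)⟩⟩,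
    fun s hs => ?_⟩
  obtain ⟨μ, hprob, hμ⟩ := hs.exists_measure hT.1 hm
  exact ⟨μ, hprob, hμ, fun f hf => hs.1.eq_integral hT.1 hRDP hm μ hμ hf.1 hf.2⟩
end

section
/- Let T be an effect-clan on a nonempty set X, partially ordered pointwise, and let f = χ_A ∈ T be the characteristic function of a subset A ⊆ X. Assume f has the central decomposition property: for every g ∈ T, the infimum g ∧ f of {g, f} in the poset T exists, the infimum g ∧ (1−f) of {g, 1−f} in T exists, and g = (g ∧ f) + (g ∧ (1−f)). Then for every g ∈ T, the pointwise product g·f belongs to T and g·f equals the infimum of g and f in T. -/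
open MeasureTheory Topology Filter

/-- Let `T` be an effect-clan on `X ≠ ∅` (ordered pointwise) and let
`f = χ_A ∈ T`.  If for every `g ∈ T` the infima `g ∧ f` and `g ∧ (1 - f)` exist in the
poset `T` and `g = (g ∧ f) + (g ∧ (1 - f))`, then for every `g ∈ T` the pointwise
product `g · f` belongs to `T` and is the infimum of `g` and `f` in `T`. -/
theorem stmt_11 {X : Type*} [Nonempty X] (T : Set (X → ℝ)) (hT : IsEffectClan T)
    (A : Set X) (hA : chi A ∈ T)
    (hcentral : ∀ g ∈ T, ∃ p ∈ T, ∃ q ∈ T,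
      (p ≤ g ∧ p ≤ chi A ∧ ∀ r ∈ T, r ≤ g → r ≤ chi A → r ≤ p) ∧
      (q ≤ g ∧ q ≤ (1 : X → ℝ) - chi A ∧
        ∀ r ∈ T, r ≤ g → r ≤ (1 : X → ℝ) - chi A → r ≤ q) ∧
      g = p + q) :
    ∀ g ∈ T, g * chi A ∈ T ∧
      g * chi A ≤ g ∧ g * chi A ≤ chi A ∧
      ∀ r ∈ T, r ≤ g → r ≤ chi A → r ≤ g * chi A := by
  intro g hg
  obtain ⟨p, hp, q, hq, ⟨hpg, hpA, hpmax⟩, ⟨-, hqA, -⟩, hsum⟩ := hcentral g hg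
  have hprod : g * chi A = p := by
    funext x
    have hp0 := (hT.1 p hp x).1
    have hq0 := (hT.1 q hq x).1
    have hpx := hpA x
    have hqx := hqA x
    have hgx := congrFun hsum x
    by_cases hx : x ∈ A <;> simp [chi, hx] at hpx hqx hgx ⊢ <;> linarith
  rw [hprod]
  exact ⟨hp, hpg, hpA, hpmax⟩
end

section
/- Let G = ℚ × ℚ be partially ordered by: (g₁, g₂) ≤ (h₁, h₂) if and only if either (g₁ < h₁ and g₂ < h₂) or (g₁, g₂) = (h₁, h₂) (the strict ordering), and let u = (1, 1). Then every state s on (G, u) has the form s(g, h) = λ·g + (1 − λ)·h for a unique λ ∈ [0, 1]; consequently the extremal states on (G, u) are exactly the two coordinate projections s₁(g, h) = g and s₀(g, h) = h. -/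
/-- The strict ordering on `ℚ × ℚ`: `g ≤ h` iff both coordinates strictly increase or
`g = h`. -/
def strictLE (g h : ℚ × ℚ) : Prop := (g.1 < h.1 ∧ g.2 < h.2) ∨ g = h

/-- A state on `(ℚ × ℚ, (1,1))` with the strict ordering. -/
def IsStateQQ (s : ℚ × ℚ → ℝ) : Prop :=
  (∀ a b : ℚ × ℚ, s (a + b) = s a + s b) ∧
  (∀ g : ℚ × ℚ, strictLE 0 g → 0 ≤ s g) ∧
  s (1, 1) = 1

/-- Extremal states on `(ℚ × ℚ, (1,1))` with the strict ordering. -/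
def IsExtremalStateQQ (s : ℚ × ℚ → ℝ) : Prop :=
  IsStateQQ s ∧
  ∀ s₁ s₂ : ℚ × ℚ → ℝ, IsStateQQ s₁ → IsStateQQ s₂ → ∀ lam : ℝ, 0 < lam → lam < 1 →
    (∀ g : ℚ × ℚ, s g = lam * s₁ g + (1 - lam) * s₂ g) → s₁ = s ∧ s₂ = s

theorem nonneg_of_forall_rat_add_mul_nonneg {a b : ℝ}
    (h : ∀ ε : ℚ, 0 < ε → 0 ≤ a + b * ε) : 0 ≤ a := by
  by_contra! ha
  have hb : 0 < |b| + 1 := by positivity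
  obtain ⟨ε, hε0, hε⟩ := exists_rat_btwn (div_pos (neg_pos.mpr ha) hb)
  rw [lt_div_iff₀ hb] at hε
  have hε' : b * ε ≤ |b| * ε := mul_le_mul_of_nonneg_right (le_abs_self b) hε0.le
  linarith [h ε (by exact_mod_cast hε0)]

theorem map_eq_of_additive {s : ℚ × ℚ → ℝ} (hs : ∀ a b, s (a + b) = s a + s b) (g : ℚ × ℚ) :
    s g = s (1, 0) * g.1 + s (0, 1) * g.2 := by
  let f : ℚ × ℚ →+ ℝ := AddMonoidHom.mk' s hs
  have hsmul (q : ℚ) (x : ℚ × ℚ) : s (q • x) = q * s x := by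
    have := map_rat_smul f q x
    rwa [Rat.smul_def] at this
  have hg : g = g.1 • ((1, 0) : ℚ × ℚ) + g.2 • ((0, 1) : ℚ × ℚ) := by
    ext <;> simp
  conv_lhs => rw [hg]
  rw [hs, hsmul, hsmul]
  ring

theorem IsStateQQ.exists_eq {s : ℚ × ℚ → ℝ} (hs : IsStateQQ s) :
    ∃ lam : ℝ, lam ∈ Set.Icc (0 : ℝ) 1 ∧
      ∀ g : ℚ × ℚ, s g = lam * (g.1 : ℝ) + (1 - lam) * (g.2 : ℝ) := by
  obtain ⟨hadd, hpos, hone⟩ := hs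
  have hlin := map_eq_of_additive hadd
  have hsum : s (1, 0) + s (0, 1) = 1 := by
    simpa [hone] using (hlin (1, 1)).symm
  have h₁ : 0 ≤ s (1, 0) := nonneg_of_forall_rat_add_mul_nonneg (b := s (0, 1)) fun ε hε => by
    have := hpos (1, ε) (Or.inl ⟨by simp, hε⟩)
    rw [hlin] at this
    simpa using this
  have h₂ : 0 ≤ s (0, 1) := nonneg_of_forall_rat_add_mul_nonneg (b := s (1, 0)) fun ε hε => by
    have := hpos (ε, 1) (Or.inl ⟨hε, by simp⟩)
    rw [hlin] at this
    simpa [add_comm] using this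
  refine ⟨s (1, 0), ⟨h₁, by linarith⟩, fun g => ?_⟩
  rw [hlin g, ← hsum]
  ring

theorem isStateQQ_fst : IsStateQQ fun g => (g.1 : ℝ) := by
  refine ⟨fun a b => by simp, fun g hg => ?_, by simp⟩
  rcases hg with h | rfl
  · exact Rat.cast_nonneg.mpr h.1.le
  · simp

theorem isStateQQ_snd : IsStateQQ fun g => (g.2 : ℝ) := by
  refine ⟨fun a b => by simp, fun g hg => ?_, by simp⟩
  rcases hg with h | rfl
  · exact Rat.cast_nonneg.mpr h.2.le
  · simp

theorem isExtremalStateQQ_fst : IsExtremalStateQQ fun g => (g.1 : ℝ) := by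
  refine ⟨isStateQQ_fst, fun s₁ s₂ hs₁ hs₂ t ht0 ht1 h => ?_⟩
  obtain ⟨a, ha, hsa⟩ := hs₁.exists_eq
  obtain ⟨b, hb, hsb⟩ := hs₂.exists_eq
  have hab : 1 = t * a + (1 - t) * b := by simpa [hsa, hsb] using h (1, 0)
  have ha1 : a = 1 := by nlinarith [ha.2, hb.2]
  have hb1 : b = 1 := by nlinarith [ha.2, hb.2]
  subst ha1 hb1
  constructor <;> ext g <;> simp [hsa, hsb]

theorem isExtremalStateQQ_snd : IsExtremalStateQQ fun g => (g.2 : ℝ) := by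
  refine ⟨isStateQQ_snd, fun s₁ s₂ hs₁ hs₂ t ht0 ht1 h => ?_⟩
  obtain ⟨a, ha, hsa⟩ := hs₁.exists_eq
  obtain ⟨b, hb, hsb⟩ := hs₂.exists_eq
  have hab : 0 = t * a + (1 - t) * b := by simpa [hsa, hsb] using h (1, 0)
  have ha0 : a = 0 := by nlinarith [ha.1, hb.1]
  have hb0 : b = 0 := by nlinarith [ha.1, hb.1]
  subst ha0 hb0
  constructor <;> ext g <;> simp [hsa, hsb]

/-- Every state on `(ℚ × ℚ, (1,1))` with the strict ordering is of the
form `s (g, h) = λ g + (1 - λ) h` for a unique `λ ∈ [0, 1]`; consequently the extremal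
states are exactly the two coordinate projections. -/
theorem stmt_15 :
    (∀ s : ℚ × ℚ → ℝ, IsStateQQ s →
      ∃! lam : ℝ, lam ∈ Set.Icc (0 : ℝ) 1 ∧
        ∀ g : ℚ × ℚ, s g = lam * (g.1 : ℝ) + (1 - lam) * (g.2 : ℝ)) ∧
    ∀ s : ℚ × ℚ → ℝ, IsStateQQ s →
      (IsExtremalStateQQ s ↔
        ((∀ g : ℚ × ℚ, s g = (g.1 : ℝ)) ∨ (∀ g : ℚ × ℚ, s g = (g.2 : ℝ)))) := by
  refine ⟨fun s hs => ?_, fun s hs => ⟨fun hext => ?_, ?_⟩⟩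
  · obtain ⟨a, ha, hsa⟩ := hs.exists_eq
    refine ⟨a, ⟨ha, hsa⟩, fun b ⟨_, hsb⟩ => ?_⟩
    have := (hsb (1, 0)).symm.trans (hsa (1, 0))
    simpa using this
  · obtain ⟨a, ha, hsa⟩ := hs.exists_eq
    rcases ha.1.eq_or_lt with rfl | ha0
    · exact Or.inr fun g => by simp [hsa]
    rcases ha.2.eq_or_lt with rfl | ha1
    · exact Or.inl fun g => by simp [hsa]
    exact Or.inl fun g =>
      (congrFun (hext.2 _ _ isStateQQ_fst isStateQQ_snd a ha0 ha1 hsa).1 g).symm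
  · rintro (h | h)
    · exact (funext h : s = _) ▸ isExtremalStateQQ_fst
    · exact (funext h : s = _) ▸ isExtremalStateQQ_snd
end

section
/- Let G = ℚ × ℚ be partially ordered by the strict ordering ((g₁, g₂) ≤ (h₁, h₂) iff (g₁ < h₁ and g₂ < h₂) or (g₁, g₂) = (h₁, h₂)), let u = (1, 1), and let a = (3/10, 3/10) and b = (7/10, 2/5), both elements of the interval [0, u]. Then s(a) + s(b) ≤ 1 for every state s on (G, u), yet there is no c ∈ G with 0 ≤ c ≤ u such that s(c) = s(a) + s(b) for every state s on (G, u). (Hence the system of functions {â : a ∈ [0,u]} on the state space, where â(s) = s(a), is not an effect-clan.) -/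
/-- States on the strictly ordered `ℚ × ℚ` are nonnegative on `{0} × ℚ≥0`, although the nonzero
elements of that ray are not positive. -/
theorem IsStateQQ.nonneg_snd {s : ℚ × ℚ → ℝ} (hs : IsStateQQ s) {q : ℚ} (hq : 0 ≤ q) :
    0 ≤ s (0, q) := by
  obtain ⟨hadd, hpos, hone⟩ := hs
  by_contra! hneg
  obtain ⟨n, hn⟩ := Archimedean.arch (2 : ℝ) (neg_pos.mpr hneg)
  have hmul : s (n • (0, q)) = n • s (0, q) := map_nsmul (AddMonoidHom.mk' s hadd) n (0, q)
  have hstrict : strictLE 0 ((1, 1) + n • (0, q)) := by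
    left
    have : (0 : ℚ) ≤ n * q := by positivity
    constructor
    · simp
    · simp only [Prod.snd_zero, Prod.snd_add, Prod.smul_snd]
      rw [nsmul_eq_mul]
      linarith
  have h := hpos _ hstrict
  rw [hadd, hone, hmul] at h
  rw [smul_neg] at hn
  linarith

/-- With `a = (3/10, 3/10)` and `b = (7/10, 2/5)` in the interval
`[0, (1,1)]` of `(ℚ × ℚ, strict order)`, we have `s a + s b ≤ 1` for every state `s`,
yet no `c` with `0 ≤ c ≤ (1,1)` satisfies `s c = s a + s b` for every state `s`. -/
theorem stmt_16 :
    (∀ s : ℚ × ℚ → ℝ, IsStateQQ s →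
      s ((3 : ℚ)/10, (3 : ℚ)/10) + s ((7 : ℚ)/10, (2 : ℚ)/5) ≤ 1) ∧
    ¬ ∃ c : ℚ × ℚ, strictLE 0 c ∧ strictLE c (1, 1) ∧
        ∀ s : ℚ × ℚ → ℝ, IsStateQQ s →
          s c = s ((3 : ℚ)/10, (3 : ℚ)/10) + s ((7 : ℚ)/10, (2 : ℚ)/5) := by
  constructor
  · intro s hs
    have hnonneg := hs.nonneg_snd (q := 3 / 10) (by norm_num)
    have hunit : s (1, 1) = s ((3 : ℚ) / 10, (3 : ℚ) / 10) +
        s ((7 : ℚ) / 10, (2 : ℚ) / 5) + s (0, 3 / 10) := by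
      rw [← hs.1, ← hs.1]
      norm_num
    linarith [hs.2.2]
  · rintro ⟨⟨x, y⟩, -, hle, hc⟩
    have hfst : IsStateQQ fun g => (g.1 : ℝ) := by
      refine ⟨fun a b => by simp, fun g hg => ?_, by simp⟩
      rcases hg with hg | rfl
      · exact Rat.cast_nonneg.mpr hg.1.le
      · simp
    have hsnd : IsStateQQ fun g => (g.2 : ℝ) := by
      refine ⟨fun a b => by simp, fun g hg => ?_, by simp⟩
      rcases hg with hg | rfl
      · exact Rat.cast_nonneg.mpr hg.2.le
      · simp
    have hx : x = 3 / 10 + 7 / 10 := by exact_mod_cast hc _ hfst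
    have hy : y = 3 / 10 + 2 / 5 := by exact_mod_cast hc _ hsnd
    subst hx hy
    norm_num [strictLE] at hle
end

section
/- Let X be an uncountable set, let a, b ∈ X be distinct, and let G be the additive group of all bounded functions f : X → ℝ such that f(x) = (f(a) + f(b))/2 for all but countably many x ∈ X, partially ordered pointwise, with the constant function 1 as strong unit. Then for every x₀ ∈ X: (i) for all f, g ∈ G with f ≥ 0 and g ≥ 0 there exists h ∈ G with 0 ≤ h, h ≤ f, h ≤ g and h(x₀) = min{f(x₀), g(x₀)}; and consequently (ii) the evaluation map s_{x₀} : G → ℝ, s_{x₀}(f) = f(x₀), is an extremal state on (G, 1). -/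
/-- A state on a unital po-group `(G, 1)` of real functions (ordered pointwise):
additive on `G`, nonnegative on nonnegative elements of `G`, normalized at `1`. -/
def IsGState {X : Type*} (G : Set (X → ℝ)) (s : (X → ℝ) → ℝ) : Prop :=
  (∀ f ∈ G, ∀ g ∈ G, s (f + g) = s f + s g) ∧
  (∀ f ∈ G, 0 ≤ f → 0 ≤ s f) ∧
  s 1 = 1

/-- Extremality of a state on `(G, 1)`: any proper convex decomposition into states is
trivial (on `G`). -/
def IsExtremalGState {X : Type*} (G : Set (X → ℝ)) (s : (X → ℝ) → ℝ) : Prop :=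
  IsGState G s ∧
  ∀ s₁ s₂ : (X → ℝ) → ℝ, IsGState G s₁ → IsGState G s₂ →
    ∀ lam : ℝ, 0 < lam → lam < 1 →
      (∀ f ∈ G, s f = lam * s₁ f + (1 - lam) * s₂ f) →
        ∀ f ∈ G, s₁ f = s f ∧ s₂ f = s f

/-- A positive additive endomorphism of `ℝ` fixing `1` is the identity. -/
theorem AddMonoidHom.apply_eq_self_of_nonneg (φ : ℝ →+ ℝ) (hφ : ∀ r, 0 ≤ r → 0 ≤ φ r)
    (h1 : φ 1 = 1) (r : ℝ) : φ r = r := by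
  have hmono : Monotone φ := fun x y hxy => by
    have := hφ (y - x) (sub_nonneg.2 hxy)
    rwa [map_sub, sub_nonneg] at this
  have hcont : Continuous φ :=
    MeasureTheory.Measure.AddMonoidHom.continuous_of_measurable φ hmono.measurable
  simpa [h1] using map_real_smul φ hcont r 1

/-- Bounded functions whose value is the average of the values at `a` and `b` outside a
countable set. -/
def averageGroup {X : Type*} (a b : X) : AddSubgroup (X → ℝ) where
  carrier := {f | (∃ C : ℝ, ∀ x, |f x| ≤ C) ∧ {x : X | f x ≠ (f a + f b) / 2}.Countable}
  zero_mem' := ⟨⟨0, by simp⟩, by simp⟩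
  add_mem' := by
    rintro f g ⟨⟨C, hC⟩, hf⟩ ⟨⟨D, hD⟩, hg⟩
    refine ⟨⟨C + D, fun x => (abs_add_le _ _).trans (add_le_add (hC x) (hD x))⟩,
      (hf.union hg).mono fun x hx => ?_⟩
    by_contra hn
    simp only [Set.mem_union, Set.mem_ofPred_eq, not_or, not_not] at hn
    exact hx (by simp only [Pi.add_apply]; linarith [hn.1, hn.2])
  neg_mem' := by
    rintro f ⟨⟨C, hC⟩, hf⟩
    refine ⟨⟨C, fun x => by simpa using hC x⟩, hf.mono fun x hx => ?_⟩
    refine fun hn => hx ?_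
    simp only [Pi.neg_apply]
    linarith

theorem const_mem_averageGroup {X : Type*} (a b : X) (r : ℝ) :
    (fun _ => r) ∈ averageGroup a b :=
  ⟨⟨|r|, fun _ => le_rfl⟩, by simp⟩

theorem exists_le_of_mem_averageGroup {X : Type*} {a b : X} (hab : a ≠ b) (x₀ : X)
    {f g : X → ℝ} (hf : f ∈ averageGroup a b) (hg : g ∈ averageGroup a b)
    (hf0 : 0 ≤ f) (hg0 : 0 ≤ g) :
    ∃ h ∈ averageGroup a b, 0 ≤ h ∧ h ≤ f ∧ h ≤ g ∧ h x₀ = min (f x₀) (g x₀) := by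
  classical
  set m := min (f x₀) (g x₀)
  have hm0 : 0 ≤ m := le_min (hf0 x₀) (hg0 x₀)
  have hmf : m ≤ f x₀ := min_le_left _ _
  have hmg : m ≤ g x₀ := min_le_right _ _
  set c : ℝ := if x₀ = a ∨ x₀ = b then m / 2 else 0 with hc
  have hc0 : 0 ≤ c := by rw [hc]; split_ifs <;> linarith
  have hcm : c ≤ m := by rw [hc]; split_ifs <;> linarith
  have hc_le : ∀ k : X → ℝ, 0 ≤ k → m ≤ k x₀ → c ≤ (k a + k b) / 2 := by
    intro k hk hmk
    have ha : 0 ≤ k a := hk a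
    have hb : 0 ≤ k b := hk b
    rw [hc]
    split_ifs with h
    · rcases h with rfl | rfl <;> linarith
    · linarith
  have hcf := hc_le f hf0 hmf
  have hcg := hc_le g hg0 hmg
  let h : X → ℝ := fun x =>
    if x = x₀ then m else if x = a ∨ x = b then 0 else min c (min (f x) (g x))
  have h0 : 0 ≤ h := fun x => by
    change 0 ≤ h x
    dsimp only [h]
    split_ifs
    exacts [hm0, le_rfl, le_min hc0 (le_min (hf0 x) (hg0 x))]
  have hm_le : ∀ x, h x ≤ m := fun x => by
    dsimp only [h]
    split_ifs
    exacts [le_rfl, hm0, (min_le_left _ _).trans hcm]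
  have havg : (h a + h b) / 2 = c := by
    dsimp only [h]
    rw [hc]
    by_cases ha : a = x₀
    · subst ha; simp [hab.symm]
    · by_cases hb : b = x₀
      · subst hb; simp [hab]
      · simp [ha, hb, Ne.symm ha, Ne.symm hb]
  refine ⟨h, ⟨⟨m, fun x => by rw [abs_of_nonneg (h0 x)]; exact hm_le x⟩, ?_⟩, h0, ?_, ?_, ?_⟩
  · refine ((hf.2.union hg.2).union (Set.toFinite {x₀, a, b}).countable).mono fun x hx => ?_
    by_contra hn
    simp only [Set.mem_union, Set.mem_ofPred_eq, Set.mem_insert_iff, Set.mem_singleton_iff,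
      not_or, not_not] at hn
    obtain ⟨⟨hfx, hgx⟩, hx0, hxa, hxb⟩ := hn
    refine hx ?_
    rw [havg]
    dsimp only [h]
    rw [if_neg hx0, if_neg (by tauto), hfx, hgx]
    exact min_eq_left (le_min hcf hcg)
  · intro x
    dsimp only [h]
    split_ifs with hx
    exacts [hx ▸ hmf, hf0 x, (min_le_right _ _).trans (min_le_left _ _)]
  · intro x
    dsimp only [h]
    split_ifs with hx
    exacts [hx ▸ hmg, hg0 x, (min_le_right _ _).trans (min_le_right _ _)]
  · simp [h]

theorem IsGState.apply_const {X : Type*} {a b : X} {s : (X → ℝ) → ℝ}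
    (hs : IsGState (averageGroup a b : Set (X → ℝ)) s) (r : ℝ) : s (fun _ => r) = r := by
  let φ : ℝ →+ ℝ := AddMonoidHom.mk' (fun r => s fun _ => r) fun x y =>
    hs.1 _ (const_mem_averageGroup a b x) _ (const_mem_averageGroup a b y)
  exact φ.apply_eq_self_of_nonneg
    (fun r hr => hs.2.1 _ (const_mem_averageGroup a b r) fun _ => hr) hs.2.2 r

/-- A state vanishing on the positive elements that vanish at `x₀` is evaluation at `x₀`. -/
theorem IsGState.apply_eq_eval {X : Type*} {a b : X} (hab : a ≠ b) {x₀ : X}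
    {s : (X → ℝ) → ℝ} (hs : IsGState (averageGroup a b : Set (X → ℝ)) s)
    (hker : ∀ f ∈ averageGroup a b, 0 ≤ f → f x₀ = 0 → s f = 0)
    {f : X → ℝ} (hf : f ∈ averageGroup a b) : s f = f x₀ := by
  have heq : ∀ k ∈ averageGroup a b, ∀ h ∈ averageGroup a b, h ≤ k → h x₀ = k x₀ →
      s k = s h := by
    intro k hk h hh hle hx
    have hadd := hs.1 _ (sub_mem hk hh) _ hh
    rwa [sub_add_cancel, hker _ (sub_mem hk hh) (sub_nonneg.2 hle) (by simp [hx]),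
      zero_add] at hadd
  have hpos : ∀ k ∈ averageGroup a b, 0 ≤ k → s k = k x₀ := by
    intro k hk hk0
    have hc := const_mem_averageGroup a b (k x₀)
    obtain ⟨h, hh, -, hhk, hhc, hx⟩ :=
      exists_le_of_mem_averageGroup hab x₀ hk hc hk0 fun _ => hk0 x₀
    rw [min_self] at hx
    rw [heq k hk h hh hhk hx, ← heq _ hc h hh hhc hx, hs.apply_const]
  obtain ⟨C, hC⟩ := hf.1
  have hc := const_mem_averageGroup a b C
  have hfc := hpos _ (add_mem hf hc) fun x => by
    have := neg_le_of_abs_le (hC x)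
    simp only [Pi.zero_apply, Pi.add_apply]
    linarith
  rw [hs.1 _ hf _ hc, hs.apply_const, Pi.add_apply] at hfc
  exact add_right_cancel hfc

/-- Let `X` be uncountable, `a ≠ b` in `X`, and let `G` be the group of
bounded functions `f : X → ℝ` with `f x = (f a + f b) / 2` for all but countably many
`x`, ordered pointwise, with strong unit `1`.  Then for every `x₀ ∈ X`: (i) for all
`f, g ∈ G` with `f, g ≥ 0` there is `h ∈ G` with `0 ≤ h ≤ f, g` and
`h x₀ = min (f x₀) (g x₀)`; and (ii) the evaluation `s_{x₀}` is an extremal state on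
`(G, 1)`. -/
theorem stmt_19 {X : Type*} [Uncountable X] (a b : X) (hab : a ≠ b)
    (G : Set (X → ℝ))
    (hG : G = {f : X → ℝ | (∃ C : ℝ, ∀ x, |f x| ≤ C) ∧
      {x : X | f x ≠ (f a + f b) / 2}.Countable}) :
    ∀ x₀ : X,
      (∀ f ∈ G, ∀ g ∈ G, 0 ≤ f → 0 ≤ g →
        ∃ h ∈ G, 0 ≤ h ∧ h ≤ f ∧ h ≤ g ∧ h x₀ = min (f x₀) (g x₀)) ∧
      IsExtremalGState G (fun f => f x₀) := by
  intro x₀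
  obtain rfl : G = (averageGroup a b : Set (X → ℝ)) := hG
  refine ⟨fun f hf g hg hf0 hg0 => exists_le_of_mem_averageGroup hab x₀ hf hg hf0 hg0,
    ⟨fun _ _ _ _ => rfl, fun _ _ hf0 => hf0 x₀, rfl⟩, ?_⟩
  intro s₁ s₂ hs₁ hs₂ lam h0 h1 hs
  have hker : ∀ f ∈ averageGroup a b, 0 ≤ f → f x₀ = 0 → s₁ f = 0 ∧ s₂ f = 0 := by
    intro f hf hf0 hx
    have hsum := hs f hf
    have h₁ := hs₁.2.1 f hf hf0
    have h₂ := hs₂.2.1 f hf hf0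
    have h1' : 0 < 1 - lam := sub_pos.2 h1
    simp only [hx] at hsum
    constructor <;> nlinarith [mul_nonneg h0.le h₁, mul_nonneg h1'.le h₂]
  exact fun f hf =>
    ⟨hs₁.apply_eq_eval hab (fun k hk hk0 hx => (hker k hk hk0 hx).1) hf,
      hs₂.apply_eq_eval hab (fun k hk hk0 hx => (hker k hk hk0 hx).2) hf⟩
end
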